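/- arXiv:2002.04599 — 2 statements merged into one kernel-verified Lean document; each statement's English description precedes it below -/
import Mathlib

section
/- Consider inputs x : Fin (d+2) → ℝ with the sup norm, a linear classifier f(x) = sign(∑_i w i · x i + C), the oracle O(x) = sign(x₀), and the set of noise coordinates S = {i : i ≥ 2} with |S| = d ≥ 1. Let v = ∑_i w i · x i + C with v ≠ 0, suppose |x₀| = 1/2, and suppose the noise weights satisfy |w i| ≥ c/√d for all i ∈ S, for some c > 0. Then for every ε with |v|/(c·√d) < ε < 1/2 there exists a perturbation Δ supported on S with ‖Δ‖∞ ≤ ε such that sign(∑_i w i · (x + Δ) i + C) ≠ sign(v) while sign((x + Δ)₀) = sign(x₀); that is, x + Δ is a sensitivity adversarial example of ℓ∞ norm O(d^{−1/2}) that changes the model's prediction but not the oracle's label. -/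
theorem sensitivity_adversarial_example_for_bayes_optimal_classifier (d : ℕ) (hd : 1 ≤ d)
    (x w : Fin (d + 2) → ℝ) (C : ℝ)
    (S : Finset (Fin (d + 2))) (hS : S = Finset.univ.filter fun i : Fin (d + 2) => 2 ≤ (i : ℕ))
    (hScard : S.card = d)
    (v : ℝ) (hv : v = ∑ i, w i * x i + C) (hv0 : v ≠ 0)
    (hx0 : |x 0| = 1 / 2)
    (c : ℝ) (hc : 0 < c) (hw : ∀ i ∈ S, c / Real.sqrt d ≤ |w i|)
    (ε : ℝ) (hε_lb : |v| / (c * Real.sqrt d) < ε) (hε_ub : ε < 1 / 2) :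
    ∃ Δ : Fin (d + 2) → ℝ, (∀ i ∉ S, Δ i = 0) ∧ ‖Δ‖ ≤ ε ∧
      Real.sign (∑ i, w i * (x + Δ) i + C) ≠ Real.sign v ∧
      Real.sign ((x + Δ) 0) = Real.sign (x 0) := by
  have hdpos : (0 : ℝ) < d := by exact_mod_cast hd
  have hsqrt : 0 < √(d : ℝ) := Real.sqrt_pos.2 hdpos
  have hε : 0 < ε := lt_of_le_of_lt (by positivity) hε_lb
  have hweights : c * √(d : ℝ) ≤ ∑ i ∈ S, |w i| := by
    have hcard := Finset.card_nsmul_le_sum S (fun i => |w i|) _ hw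
    rw [hScard, nsmul_eq_mul] at hcard
    have hscale : c * √(d : ℝ) = d * (c / √(d : ℝ)) := by
      rw [mul_div_assoc', eq_div_iff hsqrt.ne', mul_assoc, Real.mul_self_sqrt hdpos.le, mul_comm]
    exact hscale.trans_le hcard
  have hmargin : |v| < ε * ∑ i ∈ S, |w i| :=
    ((div_lt_iff₀ (by positivity)).1 hε_lb).trans_le (by gcongr)
  have h0 : (0 : Fin (d + 2)) ∉ S := by simp [hS]
  have hbound (r : ℝ) : |Real.sign r| ≤ 1 := by
    rcases Real.sign_apply_eq r with h | h | h <;> simp [h]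
  set Δ : Fin (d + 2) → ℝ :=
    fun i => if i ∈ S then -(ε * Real.sign v * Real.sign (w i)) else 0 with hΔ
  have hshift : ∑ i, w i * (x + Δ) i + C = v - Real.sign v * (ε * ∑ i ∈ S, |w i|) := by
    have hsum : ∑ i, w i * Δ i = -(Real.sign v * (ε * ∑ i ∈ S, |w i|)) := by
      simp only [hΔ, mul_ite, mul_zero, Finset.sum_ite_mem, Finset.univ_inter,
        Finset.mul_sum, ← Finset.sum_neg_distrib]
      refine Finset.sum_congr rfl fun i _ => ?_
      have hsign : w i * Real.sign (w i) = |w i| := by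
        rcases lt_trichotomy (w i) 0 with h | h | h
        · simp [Real.sign_of_neg h, abs_of_neg h]
        · simp [h]
        · simp [Real.sign_of_pos h, abs_of_pos h]
      rw [← hsign]
      ring
    simp only [Pi.add_apply, mul_add, Finset.sum_add_distrib, hsum]
    rw [hv]
    ring
  refine ⟨Δ, fun i hi => by simp [hΔ, hi], ?_, ?_, by simp [hΔ, h0]⟩
  · refine (pi_norm_le_iff_of_nonneg hε.le).2 fun i => ?_
    by_cases hi : i ∈ S
    · simp only [hΔ, hi, if_true, Real.norm_eq_abs, abs_neg, abs_mul, abs_of_pos hε]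
      have := mul_le_one₀ (hbound v) (abs_nonneg _) (hbound (w i))
      rw [mul_assoc]
      exact mul_le_of_le_one_right hε.le this
    · simp [hΔ, hi, hε.le]
  · rw [hshift]
    rcases lt_or_gt_of_ne hv0 with h | h
    · rw [abs_of_neg h] at hmargin
      rw [Real.sign_of_neg h, Real.sign_of_pos (by linarith)]
      norm_num
    · rw [abs_of_pos h] at hmargin
      rw [Real.sign_of_pos h, Real.sign_of_neg (by linarith)]
      norm_num
end

section
/- Consider inputs x : Fin (d+2) → ℝ with the sup norm, the overly-robust classifier f(x) = sign(x₁), and the oracle O(x) = sign(x₀). For any x with |x₀| = 1/2 and |x₁| = 1, there exists a perturbation Δ with ‖Δ‖∞ ≤ 0.99 such that f(x + Δ) ≠ O(x + Δ), i.e. sign((x + Δ)₁) ≠ sign((x + Δ)₀). Thus the overly-robust classifier disagrees with the oracle under a perturbation of ℓ∞ norm at most 0.99 at every point of the support, making it vulnerable to invariance adversarial examples. -/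
theorem overly_robust_classifier_has_invariance_adversarial_examples (d : ℕ)
    (x : Fin (d + 2) → ℝ)
    (hx0 : |x 0| = 1 / 2)
    (hx1 : |x 1| = 1) :
    ∃ Δ : Fin (d + 2) → ℝ, ‖Δ‖ ≤ 0.99 ∧
      Real.sign ((x + Δ) 1) ≠ Real.sign ((x + Δ) 0) := by
  refine ⟨Pi.single 0 (-0.99 * x 1), ?_, ?_⟩
  · rw [Pi.norm_single, norm_mul, Real.norm_eq_abs, Real.norm_eq_abs, hx1]
    norm_num [abs_of_pos]
  · obtain ⟨hl, hu⟩ := abs_le.mp hx0.le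
    have h10 : (1 : Fin (d + 2)) ≠ 0 := one_ne_zero
    simp only [Pi.add_apply, Pi.single_eq_same, Pi.single_eq_of_ne h10, add_zero]
    rcases eq_or_eq_neg_of_abs_eq hx1 with h | h <;> rw [h]
    · rw [Real.sign_of_pos one_pos, Real.sign_of_neg (by linarith)]
      norm_num
    · rw [Real.sign_of_neg (by norm_num), Real.sign_of_pos (by linarith)]
      norm_num
end
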